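/- arXiv:2303.15864 — 13 statements merged into one kernel-verified Lean document; each statement's English description precedes it below -/
import Mathlib

section
/- Let N ≥ 1, let P ∈ ℂ[x₀,…,x_N] be a nonzero homogeneous polynomial of degree D, let p = (p₁,…,p_N) ∈ ℂ^N, and let m ≥ 1 be such that the point p has multiplicity at least m on the hypersurface {P=0}, i.e., in the polynomial P(1, p₁+t₁, …, p_N+t_N) ∈ ℂ[t₁,…,t_N] every monomial with nonzero coefficient has total degree at least m. Let K, X₀, X₁, …, X_N ∈ ℂ[x₀,…,x_N] be polynomials such that K divides X_i − p_i·X₀ for every i = 1,…,N. Then K^m divides the polynomial P(X₀, X₁, …, X_N) in ℂ[x₀,…,x_N]. -/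
open MvPolynomial

/-- Dehomogenizing at the zeroth variable preserves the coefficients of a homogeneous polynomial. -/
lemma coeff_tail_aeval_cons_one {R : Type*} [CommRing R] {N D : ℕ}
    {P : MvPolynomial (Fin (N + 1)) R} (hP : P.IsHomogeneous D)
    {e : Fin (N + 1) →₀ ℕ} (he : e.degree = D) :
    coeff e.tail (aeval (Fin.cons (1 : MvPolynomial (Fin N) R) X) P) = coeff e P := by
  classical
  have degree_eq (f : Fin (N + 1) →₀ ℕ) : f.degree = f 0 + f.tail.degree := by
    simp [Finsupp.degree_eq_sum, Fin.sum_univ_succ, Finsupp.tail_apply]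
  have monomial_eq (f : Fin (N + 1) →₀ ℕ) (a : R) :
      aeval (Fin.cons (1 : MvPolynomial (Fin N) R) X) (monomial f a) = monomial f.tail a := by
    rw [aeval_monomial, monomial_eq, Finsupp.prod_fintype _ _ (by simp),
      Finsupp.prod_fintype _ _ (by simp), Fin.prod_univ_succ]
    simp [Finsupp.tail_apply, algebraMap_eq]
  conv_lhs => rw [P.as_sum, map_sum, coeff_sum]
  simp only [monomial_eq, coeff_monomial]
  rw [Finset.sum_eq_single e]
  · simp
  · intro f hf hfe
    refine if_neg fun htail => hfe ?_
    have hfD : f.degree = D := by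
      rw [Finsupp.degree_eq_weight_one]
      exact hP (mem_support_iff.mp hf)
    have hzero : f 0 = e 0 := by
      have hf' := degree_eq f
      have he' := degree_eq e
      rw [htail] at hf'
      omega
    rw [← Finsupp.cons_tail f, ← Finsupp.cons_tail e, htail, hzero]
  · intro h
    simpa using h

/-- If the dehomogenization of a homogeneous polynomial has order at least `m` at the origin, then
substituting multiples of `K` for all variables but the zeroth gives a multiple of `K ^ m`. -/
lemma pow_dvd_aeval_of_le_degree_dehomogenization {R A : Type*} [CommRing R] [CommRing A]
    [Algebra R A] {N D m : ℕ} {P : MvPolynomial (Fin (N + 1)) R} (hP : P.IsHomogeneous D)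
    (hm : ∀ d ∈ (aeval (Fin.cons (1 : MvPolynomial (Fin N) R) X) P).support, m ≤ d.degree)
    {K : A} {Y : Fin (N + 1) → A} (hY : ∀ i : Fin N, K ∣ Y i.succ) :
    K ^ m ∣ aeval Y P := by
  rw [aeval_def, eval₂_eq']
  refine Finset.dvd_sum fun e he => Dvd.dvd.mul_left ?_ _
  have heD : e.degree = D := by
    rw [Finsupp.degree_eq_weight_one]
    exact hP (mem_support_iff.mp he)
  have hme : m ≤ e.tail.degree := hm _ <| by
    rw [mem_support_iff, coeff_tail_aeval_cons_one hP heD]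
    exact mem_support_iff.mp he
  rw [Fin.prod_univ_succ]
  refine ((pow_dvd_pow K hme).trans ?_).mul_left _
  rw [Finsupp.degree_eq_sum, ← Finset.prod_pow_eq_pow_sum]
  exact Finset.prod_dvd_prod_of_dvd _ _ fun i _ => pow_dvd_pow_of_dvd (hY i) _

/-- Proposition 4.1 (algebraic content): if `P` is a nonzero homogeneous polynomial of
degree `D` in `ℂ[x₀,…,x_N]` such that the point `p = [1:p₁:…:p_N]` has multiplicity at
least `m ≥ 1` on `{P=0}` (every monomial of `P(1, p₁+t₁, …, p_N+t_N)` with nonzero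
coefficient has total degree `≥ m`), and `K ∣ Xᵢ − pᵢ·X₀` for `i = 1,…,N`, then
`K^m ∣ P(X₀, X₁, …, X_N)`. -/
theorem stmt0 (N : ℕ) (hN : 1 ≤ N)
    (P : MvPolynomial (Fin (N + 1)) ℂ) (hP : P ≠ 0) (D : ℕ)
    (hPhom : P.IsHomogeneous D)
    (p : Fin N → ℂ) (m : ℕ) (hm : 1 ≤ m)
    (hmult : ∀ d ∈ (aeval
        (Fin.cons (1 : MvPolynomial (Fin N) ℂ)
          (fun i : Fin N => MvPolynomial.C (p i) + MvPolynomial.X i)) P).support,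
        m ≤ d.sum fun _ e => e)
    (K : MvPolynomial (Fin (N + 1)) ℂ)
    (Xs : Fin (N + 1) → MvPolynomial (Fin (N + 1)) ℂ)
    (hdvd : ∀ i : Fin N, K ∣ Xs i.succ - MvPolynomial.C (p i) * Xs 0) :
    K ^ m ∣ aeval Xs P := by
  set P' : MvPolynomial (Fin (N + 1)) ℂ :=
    aeval (Fin.cons (X 0) fun i : Fin N => C (p i) * X 0 + X i.succ) P with hP'
  have hP'hom : P'.IsHomogeneous D := by
    rw [← one_mul D]
    refine hPhom.aeval _ fun i => ?_
    refine Fin.cases ?_ (fun j => ?_) i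
    · exact isHomogeneous_X _ _
    · exact (isHomogeneous_C_mul_X _ _).add (isHomogeneous_X _ _)
  have hdehom : aeval (Fin.cons (1 : MvPolynomial (Fin N) ℂ) X) P' =
      aeval (Fin.cons (1 : MvPolynomial (Fin N) ℂ) fun i => C (p i) + X i) P := by
    rw [hP', comp_aeval_apply]
    congr 2
    funext i
    refine Fin.cases ?_ (fun j => ?_) i <;> simp [algebraMap_eq]
  have hsubst : aeval (Fin.cons (Xs 0) fun i : Fin N => Xs i.succ - C (p i) * Xs 0) P' =
      aeval Xs P := by
    rw [hP', comp_aeval_apply]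
    congr 2
    funext i
    refine Fin.cases ?_ (fun j => ?_) i <;> simp [algebraMap_eq]
  rw [← hsubst]
  refine pow_dvd_aeval_of_le_degree_dehomogenization hP'hom ?_ (by simpa using hdvd)
  rw [hdehom]
  exact hmult
end

section
/- Let P ∈ ℂ[x,y,z] be a nonzero homogeneous polynomial, and let ν₂(P) be the unique natural number such that P(u, 1, u²v) = u^{ν₂(P)}·Q(u,v) in ℂ[u,v] with Q not divisible by u. Then (y−z)^{ν₂(P)} divides P(y(y−z), xz, (y−z)²) in ℂ[x,y,z], and (y−z)^{ν₂(P)+1} does not divide it. -/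
open MvPolynomial

/-- Evaluation of a polynomial in three variables as an explicit sum over its support. -/
lemma aeval_fin_three_eq_sum {A : Type*} [CommRing A] [Algebra ℂ A] (a b c : A)
    (P : MvPolynomial (Fin 3) ℂ) :
    aeval ![a, b, c] P
      = ∑ m ∈ P.support, algebraMap ℂ A (P.coeff m) * (a ^ m 0 * b ^ m 1 * c ^ m 2) := by
  simp [aeval_def, eval₂_eq', Fin.prod_univ_three]

/-- The coefficient of a sum of scaled monomials in two variables with distinct exponents. -/
lemma coeff_sum_X_pow_mul_X_pow {ι : Type*} (s : Finset ι) (c : ι → ℂ) (p q : ι → ℕ)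
    {i : ι} (hi : i ∈ s) (hinj : ∀ j ∈ s, p j = p i → q j = q i → j = i) :
    coeff (Finsupp.single 0 (p i) + Finsupp.single 1 (q i))
      (∑ j ∈ s, C (c j) * (X 0 ^ p j * X 1 ^ q j) : MvPolynomial (Fin 2) ℂ) = c i := by
  classical
  rw [coeff_sum, Finset.sum_eq_single_of_mem i hi]
  · simp [X_pow_eq_monomial, monomial_mul, coeff_C_mul]
  · intro j hj hne
    rw [X_pow_eq_monomial, X_pow_eq_monomial, monomial_mul, coeff_C_mul, coeff_monomial,
      if_neg, mul_zero]
    intro h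
    have h0 := DFunLike.congr_fun h 0
    have h1 := DFunLike.congr_fun h 1
    simp at h0 h1
    exact hne (hinj j hj h0 h1)

/-- The exponents of a monomial of a homogeneous polynomial in three variables sum to its degree. -/
lemma MvPolynomial.IsHomogeneous.sum_exponents_fin_three {P : MvPolynomial (Fin 3) ℂ} {D : ℕ}
    (hP : P.IsHomogeneous D) {m : Fin 3 →₀ ℕ} (hm : m ∈ P.support) : m 0 + m 1 + m 2 = D := by
  have h := hP (mem_support_iff.mp hm)
  rw [Finsupp.weight_apply, Finsupp.sum_fintype _ _ (by simp), Fin.sum_univ_three] at h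
  simpa using h

/-- Pull-back to the chart `(u, v) ↦ [u : 1 : u²v]` as a sum of monomials. -/
lemma aeval_chart_eq_sum (P : MvPolynomial (Fin 3) ℂ) :
    aeval (![X 0, 1, X 0 ^ 2 * X 1] : Fin 3 → MvPolynomial (Fin 2) ℂ) P
      = ∑ m ∈ P.support, C (P.coeff m) * (X 0 ^ (m 0 + 2 * m 2) * X 1 ^ m 2) := by
  rw [aeval_fin_three_eq_sum]
  refine Finset.sum_congr rfl fun m _ => ?_
  rw [algebraMap_eq]
  ring

/-- If `u ^ k` divides the chart pull-back of a homogeneous polynomial, every monomial has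
weight at least `k`. -/
lemma le_weight_of_X_pow_dvd_aeval_chart {P : MvPolynomial (Fin 3) ℂ} {D k : ℕ}
    (hP : P.IsHomogeneous D)
    (h : X 0 ^ k ∣ aeval (![X 0, 1, X 0 ^ 2 * X 1] : Fin 3 → MvPolynomial (Fin 2) ℂ) P)
    {m : Fin 3 →₀ ℕ} (hm : m ∈ P.support) : k ≤ m 0 + 2 * m 2 := by
  by_contra! hlt
  have hcoeff := coeff_sum_X_pow_mul_X_pow P.support (fun n => P.coeff n)
    (fun n => n 0 + 2 * n 2) (fun n => n 2) hm fun n hn h0 h2 => by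
      have hnD := hP.sum_exponents_fin_three hn
      have hmD := hP.sum_exponents_fin_three hm
      ext i
      fin_cases i <;> simp at h0 h2 ⊢ <;> omega
  obtain ⟨R, hR⟩ := h
  rw [← aeval_chart_eq_sum, hR, X_pow_eq_monomial, coeff_monomial_mul', if_neg] at hcoeff
  · exact mem_support_iff.mp hm hcoeff.symm
  · intro hle
    have := hle 0
    simp at this
    omega

/-- A lower bound on the weights gives divisibility of the chart pull-back by a power of `u`. -/
lemma X_pow_dvd_aeval_chart {P : MvPolynomial (Fin 3) ℂ} {k : ℕ}
    (h : ∀ m ∈ P.support, k ≤ m 0 + 2 * m 2) :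
    X 0 ^ k ∣ aeval (![X 0, 1, X 0 ^ 2 * X 1] : Fin 3 → MvPolynomial (Fin 2) ℂ) P := by
  rw [aeval_chart_eq_sum]
  exact Finset.dvd_sum fun m hm =>
    Dvd.dvd.mul_left (Dvd.dvd.mul_right (pow_dvd_pow _ (h m hm)) _) _

/-- The power `(y - z) ^ k` splits off the pull-back by the dPI map when all weights are at
least `k`. -/
lemma aeval_dPI_eq_pow_mul_sum {P : MvPolynomial (Fin 3) ℂ} {k : ℕ}
    (h : ∀ m ∈ P.support, k ≤ m 0 + 2 * m 2) :
    aeval (![X 1 * (X 1 - X 2), X 0 * X 2, (X 1 - X 2) ^ 2] :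
        Fin 3 → MvPolynomial (Fin 3) ℂ) P
      = (X 1 - X 2) ^ k * ∑ m ∈ P.support, C (P.coeff m) *
          ((X 1 - X 2) ^ (m 0 + 2 * m 2 - k) * X 1 ^ m 0 * (X 0 * X 2) ^ m 1) := by
  rw [aeval_fin_three_eq_sum, Finset.mul_sum]
  refine Finset.sum_congr rfl fun m hm => ?_
  obtain ⟨j, hj⟩ := Nat.exists_eq_add_of_le (h m hm)
  have hw : (X 1 - X 2 : MvPolynomial (Fin 3) ℂ) ^ m 0 * ((X 1 - X 2) ^ 2) ^ m 2
      = (X 1 - X 2) ^ k * (X 1 - X 2) ^ j := by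
    rw [← pow_mul, ← pow_add, ← pow_add, hj]
  rw [algebraMap_eq, hj, Nat.add_sub_cancel_left, mul_pow]
  linear_combination C (P.coeff m) * X 1 ^ m 0 * (X 0 * X 2) ^ m 1 * hw

/-- Part 1 of Proposition `lemma prefactor z y-z` (Example 2, the dPI map
`f[x:y:z] = [y(y−z) : xz : (y−z)²]`): if `ν₂(P)` is the local index of a nonzero
homogeneous polynomial `P` with respect to the blow-up chart `(u,v) ↦ [u : 1 : u²v]`,
i.e. `P(u,1,u²v) = u^{ν₂(P)}·Q(u,v)` with `u ∤ Q`, then `(y−z)^{ν₂(P)}` divides the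
pull-back `f*P = P(y(y−z), xz, (y−z)²)` and `(y−z)^{ν₂(P)+1}` does not. -/
theorem stmt1 (P : MvPolynomial (Fin 3) ℂ) (hP : P ≠ 0) (D : ℕ)
    (hPhom : P.IsHomogeneous D)
    (k : ℕ) (Q : MvPolynomial (Fin 2) ℂ)
    (hQ : ¬ (X 0 : MvPolynomial (Fin 2) ℂ) ∣ Q)
    (hfact : aeval (![X 0, 1, X 0 ^ 2 * X 1] : Fin 3 → MvPolynomial (Fin 2) ℂ) P
      = X 0 ^ k * Q) :
    ((X 1 - X 2 : MvPolynomial (Fin 3) ℂ) ^ k ∣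
        aeval (![X 1 * (X 1 - X 2), X 0 * X 2, (X 1 - X 2) ^ 2] :
          Fin 3 → MvPolynomial (Fin 3) ℂ) P) ∧
    ¬ ((X 1 - X 2 : MvPolynomial (Fin 3) ℂ) ^ (k + 1) ∣
        aeval (![X 1 * (X 1 - X 2), X 0 * X 2, (X 1 - X 2) ^ 2] :
          Fin 3 → MvPolynomial (Fin 3) ℂ) P) := by
  have hle : ∀ m ∈ P.support, k ≤ m 0 + 2 * m 2 := fun m hm =>
    le_weight_of_X_pow_dvd_aeval_chart hPhom ⟨Q, hfact⟩ hm
  obtain ⟨m, hm, hmk⟩ : ∃ m ∈ P.support, m 0 + 2 * m 2 = k := by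
    by_contra! hne
    have hdvd := X_pow_dvd_aeval_chart (k := k + 1) fun m hm =>
      (hle m hm).lt_of_ne (hne m hm).symm
    rw [hfact, pow_succ] at hdvd
    exact hQ ((mul_dvd_mul_iff_left (pow_ne_zero k (X_ne_zero 0))).mp hdvd)
  have hw : (X 1 - X 2 : MvPolynomial (Fin 3) ℂ) ≠ 0 :=
    sub_ne_zero.mpr fun h => absurd (X_injective h) (by decide)
  rw [aeval_dPI_eq_pow_mul_sum hle]
  refine ⟨dvd_mul_right _ _, fun hdvd => ?_⟩
  rw [pow_succ, mul_dvd_mul_iff_left (pow_ne_zero k hw)] at hdvd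
  -- restrict to the critical line `y = z`
  have hzero := map_dvd (aeval (![X 0, X 1, X 1] : Fin 3 → MvPolynomial (Fin 2) ℂ)) hdvd
  have hsum : ∑ n ∈ P.support with n 0 + 2 * n 2 = k,
      C (P.coeff n) * (X 0 ^ n 1 * X 1 ^ (n 0 + n 1)) = (0 : MvPolynomial (Fin 2) ℂ) := by
    rw [Finset.sum_filter]
    simp only [map_sub, aeval_X, Matrix.cons_val, sub_self, zero_dvd_iff, map_sum, map_mul,
      map_pow, algHom_C, algebraMap_eq] at hzero
    refine (Finset.sum_congr rfl fun n hn => ?_).trans hzero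
    split_ifs with hnk
    · rw [hnk, Nat.sub_self]
      ring
    · have := hle n hn
      rw [zero_pow (by omega)]
      ring
  have hcoeff := coeff_sum_X_pow_mul_X_pow {n ∈ P.support | n 0 + 2 * n 2 = k}
    (fun n => P.coeff n) (fun n => n 1) (fun n => n 0 + n 1) (i := m) (by simp_all) ?_
  · rw [hsum, coeff_zero] at hcoeff
    exact mem_support_iff.mp hm hcoeff.symm
  · intro n hn h1 h01
    have hnD := hPhom.sum_exponents_fin_three (Finset.mem_filter.mp hn).1
    have hmD := hPhom.sum_exponents_fin_three hm
    ext i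
    fin_cases i <;> simp at h1 h01 ⊢ <;> omega
end

section
/- Let P ∈ ℂ[x,y,z] be a nonzero homogeneous polynomial, and let ν₃(P) be the unique natural number such that P(1, uv, 1−u) = u^{ν₃(P)}·Q(u,v) in ℂ[u,v] with Q not divisible by u. Then z^{ν₃(P)} divides P(y(y−z), xz, (y−z)²) in ℂ[x,y,z], and z^{ν₃(P)+1} does not divide it. -/
open MvPolynomial

/-- Scaling the arguments of a homogeneous polynomial scales its value. -/
theorem MvPolynomial.IsHomogeneous.aeval_const_mul {σ R A : Type*} [CommSemiring R]
    [CommSemiring A] [Algebra R A] {P : MvPolynomial σ R} {D : ℕ} (hP : P.IsHomogeneous D)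
    (c : A) (f : σ → A) :
    MvPolynomial.aeval (fun i => c * f i) P = c ^ D * MvPolynomial.aeval f P := by
  rw [aeval_def, eval₂_eq, aeval_def, eval₂_eq, Finset.mul_sum]
  refine Finset.sum_congr rfl fun d hd => ?_
  have hdeg : ∑ i ∈ d.support, d i = D := by
    rw [← Finsupp.degree_apply, Finsupp.degree_eq_weight_one]
    exact hP (mem_support_iff.mp hd)
  simp_rw [mul_pow, Finset.prod_mul_distrib, Finset.prod_pow_eq_pow_sum, hdeg]
  ring

/-- A variable does not divide a polynomial that survives setting that variable to zero at a
point. -/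
theorem MvPolynomial.not_X_dvd_of_eval_ne_zero {σ R : Type*} [CommRing R] {i : σ}
    {p : MvPolynomial σ R} (a : σ → R) (ha : a i = 0) (hp : eval a p ≠ 0) : ¬ X i ∣ p := by
  rintro ⟨q, rfl⟩
  simp [ha] at hp

/-- The substitution `(x, y, z) = (v(1-u), 1, u)` turns the pull-back of a homogeneous polynomial
into its expression in the chart `(u, v) ↦ [1 : uv : 1-u]`, up to a power of `1 - u`. -/
theorem aeval_chart_pullback {P : MvPolynomial (Fin 3) ℂ} {D : ℕ} (hP : P.IsHomogeneous D) :
    aeval (![X 1 * (1 - X 0), 1, X 0] : Fin 3 → MvPolynomial (Fin 2) ℂ)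
        (aeval (![X 1 * (X 1 - X 2), X 0 * X 2, (X 1 - X 2) ^ 2] :
          Fin 3 → MvPolynomial (Fin 3) ℂ) P) =
      (1 - X 0) ^ D *
        aeval (![1, X 0 * X 1, 1 - X 0] : Fin 3 → MvPolynomial (Fin 2) ℂ) P := by
  rw [← hP.aeval_const_mul, ← AlgHom.comp_apply, comp_aeval]
  congr 2
  funext i
  fin_cases i <;> simp <;> ring

/-- If the image of `P` in the chart is `u ^ k * Q`, then the pull-back of `P` is divisible by
`z ^ k` after multiplication by suitable powers of `y` and `y - z`. -/
theorem exists_pow_dvd_mul_pullback {P : MvPolynomial (Fin 3) ℂ} {D : ℕ}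
    (hP : P.IsHomogeneous D) {k : ℕ} {Q : MvPolynomial (Fin 2) ℂ}
    (hfact : aeval (![1, X 0 * X 1, 1 - X 0] : Fin 3 → MvPolynomial (Fin 2) ℂ) P
      = X 0 ^ k * Q) :
    ∃ n : ℕ, (X 2 : MvPolynomial (Fin 3) ℂ) ^ k ∣
      (X 1 ^ k * (X 1 * (X 1 - X 2)) ^ n) *
        aeval (![X 1 * (X 1 - X 2), X 0 * X 2, (X 1 - X 2) ^ 2] :
          Fin 3 → MvPolynomial (Fin 3) ℂ) P := by
  set t : MvPolynomial (Fin 3) ℂ := X 1 * (X 1 - X 2) with ht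
  have ht0 : t ≠ 0 := by
    intro h
    simpa [ht] using congrArg (eval ![0, 1, 0]) h
  let L := Localization.Away t
  let φ : MvPolynomial (Fin 3) ℂ →ₐ[ℂ] L := Algebra.algHom ℂ _ _
  have hφ : Function.Injective φ :=
    IsLocalization.injective L (powers_le_nonZeroDivisors_of_noZeroDivisors ht0)
  obtain ⟨s, hs⟩ := (IsLocalization.Away.algebraMap_isUnit (S := L) t).exists_right_inv
  replace hs : φ (X 1) * (φ (X 1) - φ (X 2)) * s = 1 := by
    rw [← map_sub, ← map_mul]
    exact hs
  let ψ : MvPolynomial (Fin 2) ℂ →ₐ[ℂ] L :=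
    aeval ![φ (X 2) * ((φ (X 1) - φ (X 2)) * s), φ (X 0) * (φ (X 1) * s)]
  obtain ⟨n, a, ha⟩ := IsLocalization.Away.surj t (ψ Q)
  replace ha : ψ Q * φ t ^ n = φ a := ha
  have hpull : φ (aeval (![t, X 0 * X 2, (X 1 - X 2) ^ 2] :
      Fin 3 → MvPolynomial (Fin 3) ℂ) P) = φ t ^ D * ψ (X 0 ^ k * Q) := by
    rw [← hfact, ← AlgHom.comp_apply, ← AlgHom.comp_apply, comp_aeval, comp_aeval,
      ← hP.aeval_const_mul]
    congr 2
    funext i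
    fin_cases i
    · simp
    · simp [ψ, ht]
      linear_combination (-φ (X 0) * φ (X 2) * (φ (X 1) * (φ (X 1) - φ (X 2)) * s + 1)) * hs
    · simp [ψ, ht]
      linear_combination ((φ (X 1) - φ (X 2)) * φ (X 2)) * hs
  refine ⟨n, t ^ D * a, hφ ?_⟩
  have hX : ψ (X 0) * φ (X 1) = φ (X 2) := by
    simp [ψ]
    linear_combination φ (X 2) * hs
  simp only [map_mul, map_pow] at hpull ⊢
  rw [hpull, ← ha, ← hX]
  ring



/-- Part 2 of Proposition `lemma prefactor z y-z` (Example 2, the dPI map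
`f[x:y:z] = [y(y−z) : xz : (y−z)²]`): if `ν₃(P)` is the local index of a nonzero
homogeneous polynomial `P` with respect to the blow-up chart `(u,v) ↦ [1 : uv : 1−u]`,
i.e. `P(1,uv,1−u) = u^{ν₃(P)}·Q(u,v)` with `u ∤ Q`, then `z^{ν₃(P)}` divides the
pull-back `f*P = P(y(y−z), xz, (y−z)²)` and `z^{ν₃(P)+1}` does not. -/
theorem stmt2 (P : MvPolynomial (Fin 3) ℂ) (hP : P ≠ 0) (D : ℕ)
    (hPhom : P.IsHomogeneous D)
    (k : ℕ) (Q : MvPolynomial (Fin 2) ℂ)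
    (hQ : ¬ (X 0 : MvPolynomial (Fin 2) ℂ) ∣ Q)
    (hfact : aeval (![1, X 0 * X 1, 1 - X 0] : Fin 3 → MvPolynomial (Fin 2) ℂ) P
      = X 0 ^ k * Q) :
    ((X 2 : MvPolynomial (Fin 3) ℂ) ^ k ∣
        aeval (![X 1 * (X 1 - X 2), X 0 * X 2, (X 1 - X 2) ^ 2] :
          Fin 3 → MvPolynomial (Fin 3) ℂ) P) ∧
    ¬ ((X 2 : MvPolynomial (Fin 3) ℂ) ^ (k + 1) ∣
        aeval (![X 1 * (X 1 - X 2), X 0 * X 2, (X 1 - X 2) ^ 2] :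
          Fin 3 → MvPolynomial (Fin 3) ℂ) P) := by
  have hX0 : Prime (X 0 : MvPolynomial (Fin 2) ℂ) := X_prime
  have hX2 : Prime (X 2 : MvPolynomial (Fin 3) ℂ) := X_prime
  constructor
  · obtain ⟨n, hn⟩ := exists_pow_dvd_mul_pullback hPhom hfact
    refine hX2.pow_dvd_of_dvd_mul_left k ?_ hn
    exact not_X_dvd_of_eval_ne_zero ![0, 1, 0] rfl (by simp)
  · intro h
    have h' := map_dvd (aeval (![X 1 * (1 - X 0), 1, X 0] : Fin 3 → MvPolynomial (Fin 2) ℂ)) h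
    rw [aeval_chart_pullback hPhom, hfact, map_pow, aeval_X, mul_left_comm, pow_succ] at h'
    have hdvd : (X 0 : MvPolynomial (Fin 2) ℂ) ∣ (1 - X 0) ^ D * Q :=
      (mul_dvd_mul_iff_left (pow_ne_zero k hX0.ne_zero)).mp h'
    rcases hX0.dvd_or_dvd hdvd with h1 | h1
    · refine not_X_dvd_of_eval_ne_zero 0 (Pi.zero_apply 0) ?_ h1
      simp
    · exact hQ h1
end

section
/- Let P ∈ ℂ[x,y,z] be a nonzero homogeneous polynomial, and let ν₁(P) be the unique natural number such that P(1, u, uv) = u^{ν₁(P)}·Q(u,v) in ℂ[u,v] with Q not divisible by u. Then (x−y+z)^{ν₁(P)} divides P(x(x−y+z)+(x−y)z, x(x−y+z), z(x−y+z)) in ℂ[x,y,z], and (x−y+z)^{ν₁(P)+1} does not divide it. -/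
open MvPolynomial

theorem aeval_fin_three {R A : Type*} [CommSemiring R] [CommSemiring A] [Algebra R A]
    (P : MvPolynomial (Fin 3) R) (a b c : A) :
    aeval ![a, b, c] P =
      ∑ d ∈ P.support, algebraMap R A (P.coeff d) * (a ^ d 0 * b ^ d 1 * c ^ d 2) := by
  rw [aeval_def, eval₂_eq']
  simp [Fin.prod_univ_three]

theorem MvPolynomial.IsHomogeneous.sum_fin_three {R : Type*} [CommSemiring R]
    {P : MvPolynomial (Fin 3) R} {D : ℕ} (hP : P.IsHomogeneous D)
    {d : Fin 3 →₀ ℕ} (hd : d ∈ P.support) : d 0 + d 1 + d 2 = D := by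
  have h := hP (mem_support_iff.mp hd)
  rwa [Finsupp.weight_apply, Finsupp.sum_fintype _ _ (by simp), Fin.sum_univ_three,
    Pi.one_apply, Pi.one_apply, Pi.one_apply, smul_eq_mul, smul_eq_mul, smul_eq_mul,
    mul_one, mul_one, mul_one] at h

/-- On a homogeneous polynomial the chart `(u, v) ↦ [1 : u : uv]` merges no two monomials. -/
theorem coeff_aeval_chart {R : Type*} [CommSemiring R] {P : MvPolynomial (Fin 3) R} {D : ℕ}
    (hP : P.IsHomogeneous D) {d : Fin 3 →₀ ℕ} (hd : d ∈ P.support) :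
    (aeval (![1, X 0, X 0 * X 1] : Fin 3 → MvPolynomial (Fin 2) R) P).coeff
      (Finsupp.single 0 (d 1 + d 2) + Finsupp.single 1 (d 2)) = P.coeff d := by
  have hterm (e : Fin 3 →₀ ℕ) :
      algebraMap R (MvPolynomial (Fin 2) R) (P.coeff e) *
          (1 ^ e 0 * X 0 ^ e 1 * (X 0 * X 1) ^ e 2) =
        monomial (Finsupp.single 0 (e 1 + e 2) + Finsupp.single 1 (e 2)) (P.coeff e) := by
    rw [← mul_one (P.coeff e), ← C_mul_monomial, mul_one, algebraMap_eq, ← one_mul (1 : R),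
      ← monomial_mul, ← X_pow_eq_monomial, ← X_pow_eq_monomial]
    ring
  rw [aeval_fin_three, coeff_sum, Finset.sum_eq_single d]
  · rw [hterm, coeff_monomial, if_pos rfl]
  · intro e he hne
    rw [hterm, coeff_monomial, if_neg]
    intro h
    apply hne
    have h0 := DFunLike.congr_fun h 0
    have h1 := DFunLike.congr_fun h 1
    simp at h0 h1
    have := hP.sum_fin_three hd
    have := hP.sum_fin_three he
    ext i
    fin_cases i <;> simp <;> omega
  · exact fun h => absurd hd h

/-- The exponent of `u` in `P(1, u, uv)` is a lower bound for the order of `P` at `[1 : 0 : 0]`. -/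
theorem le_of_X_pow_dvd_chart {R : Type*} [CommSemiring R] {P : MvPolynomial (Fin 3) R} {D : ℕ}
    (hP : P.IsHomogeneous D) {k : ℕ}
    (hk : X 0 ^ k ∣ aeval (![1, X 0, X 0 * X 1] : Fin 3 → MvPolynomial (Fin 2) R) P)
    {d : Fin 3 →₀ ℕ} (hd : d ∈ P.support) : k ≤ d 1 + d 2 := by
  obtain ⟨Q, hQ⟩ := hk
  have h := coeff_aeval_chart hP hd
  rw [hQ, X_pow_eq_monomial, coeff_monomial_mul'] at h
  split_ifs at h with hle
  · simpa using hle 0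
  · exact absurd h.symm (mem_support_iff.mp hd)

theorem X_pow_dvd_chart {R : Type*} [CommSemiring R] {P : MvPolynomial (Fin 3) R} {k : ℕ}
    (hk : ∀ d ∈ P.support, k ≤ d 1 + d 2) :
    X 0 ^ k ∣ aeval (![1, X 0, X 0 * X 1] : Fin 3 → MvPolynomial (Fin 2) R) P := by
  rw [aeval_fin_three]
  refine Finset.dvd_sum fun d hd => (pow_dvd_pow (X 0) (hk d hd)).trans ?_
  exact ⟨algebraMap _ _ (P.coeff d) * X 1 ^ d 2, by ring⟩

/-- Part 1 of Proposition 12.1 (Example 3, the linearizable map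
`f[x:y:z] = [x(x−y+z)+(x−y)z : x(x−y+z) : z(x−y+z)]`): if `ν₁(P)` is the local index of
a nonzero homogeneous polynomial `P` with respect to the blow-up chart
`(u,v) ↦ [1 : u : uv]`, i.e. `P(1,u,uv) = u^{ν₁(P)}·Q(u,v)` with `u ∤ Q`, then
`(x−y+z)^{ν₁(P)}` divides the pull-back `f*P` and `(x−y+z)^{ν₁(P)+1}` does not. -/
theorem stmt3 (P : MvPolynomial (Fin 3) ℂ) (hP : P ≠ 0) (D : ℕ)
    (hPhom : P.IsHomogeneous D)
    (k : ℕ) (Q : MvPolynomial (Fin 2) ℂ)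
    (hQ : ¬ (X 0 : MvPolynomial (Fin 2) ℂ) ∣ Q)
    (hfact : aeval (![1, X 0, X 0 * X 1] : Fin 3 → MvPolynomial (Fin 2) ℂ) P
      = X 0 ^ k * Q) :
    ((X 0 - X 1 + X 2 : MvPolynomial (Fin 3) ℂ) ^ k ∣
        aeval (![X 0 * (X 0 - X 1 + X 2) + (X 0 - X 1) * X 2,
          X 0 * (X 0 - X 1 + X 2), X 2 * (X 0 - X 1 + X 2)] :
          Fin 3 → MvPolynomial (Fin 3) ℂ) P) ∧
    ¬ ((X 0 - X 1 + X 2 : MvPolynomial (Fin 3) ℂ) ^ (k + 1) ∣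
        aeval (![X 0 * (X 0 - X 1 + X 2) + (X 0 - X 1) * X 2,
          X 0 * (X 0 - X 1 + X 2), X 2 * (X 0 - X 1 + X 2)] :
          Fin 3 → MvPolynomial (Fin 3) ℂ) P) := by
  have hle : ∀ d ∈ P.support, k ≤ d 1 + d 2 := fun d hd =>
    le_of_X_pow_dvd_chart hPhom ⟨Q, hfact⟩ hd
  obtain ⟨e, he, hek⟩ : ∃ e ∈ P.support, e 1 + e 2 = k := by
    by_contra! hne
    have h := X_pow_dvd_chart (k := k + 1) fun d hd =>
      Nat.succ_le_of_lt (lt_of_le_of_ne (hle d hd) (hne d hd).symm)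
    rw [hfact, pow_succ] at h
    exact hQ ((mul_dvd_mul_iff_left (pow_ne_zero k (X_ne_zero 0))).mp h)
  set L : MvPolynomial (Fin 3) ℂ := X 0 - X 1 + X 2 with hL
  set A : MvPolynomial (Fin 3) ℂ := X 0 * L + (X 0 - X 1) * X 2 with hA
  set S : MvPolynomial (Fin 3) ℂ := ∑ d ∈ P.support,
    C (P.coeff d) * (A ^ d 0 * X 0 ^ d 1 * X 2 ^ d 2 * L ^ (d 1 + d 2 - k)) with hS
  have hpull : aeval ![A, X 0 * L, X 2 * L] P = L ^ k * S := by
    rw [aeval_fin_three, hS, Finset.mul_sum]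
    refine Finset.sum_congr rfl fun d hd => ?_
    have hpow : L ^ d 1 * L ^ d 2 = L ^ k * L ^ (d 1 + d 2 - k) := by
      rw [← pow_add, ← pow_add, Nat.add_sub_cancel' (hle d hd)]
    rw [algebraMap_eq, mul_pow, mul_pow]
    linear_combination (C (P.coeff d) * A ^ d 0 * X 0 ^ d 1 * X 2 ^ d 2) * hpow
  -- Restrict to the affine line `(t, t + 1, 1)` contained in `L = 0`.
  let φ : MvPolynomial (Fin 3) ℂ →ₐ[ℂ] Polynomial ℂ :=
    aeval ![Polynomial.X, Polynomial.X + 1, 1]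
  have hφL : φ L = 0 := by simp [φ, hL]
  have hφA : φ A = Polynomial.C (-1) := by
    rw [hA, map_add, map_mul, hφL]
    simp [φ]
  have hφS : (φ S).coeff (e 1) = P.coeff e * (-1) ^ e 0 := by
    have hterm (d : Fin 3 →₀ ℕ) :
        φ (C (P.coeff d) * (A ^ d 0 * X 0 ^ d 1 * X 2 ^ d 2 * L ^ (d 1 + d 2 - k))) =
          Polynomial.C (P.coeff d * (-1) ^ d 0) * Polynomial.X ^ d 1 *
            0 ^ (d 1 + d 2 - k) := by
      simp only [map_mul, map_pow, hφL, hφA]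
      simp [φ]
      ring
    rw [hS, map_sum, Polynomial.finsetSum_coeff, Finset.sum_eq_single e]
    · rw [hterm, hek, Nat.sub_self, pow_zero, mul_one, Polynomial.coeff_C_mul_X_pow, if_pos rfl]
    · intro d hd hne
      rw [hterm]
      by_cases hdk : d 1 + d 2 = k
      · rw [hdk, Nat.sub_self, pow_zero, mul_one, Polynomial.coeff_C_mul_X_pow, if_neg]
        intro h
        apply hne
        have := hPhom.sum_fin_three hd
        have := hPhom.sum_fin_three he
        ext i
        fin_cases i <;> simp <;> omega
      · have := hle d hd
        rw [zero_pow (by omega), mul_zero, Polynomial.coeff_zero]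
    · exact fun h => absurd he h
  have hL0 : L ≠ 0 := by
    intro h
    have := congrArg (eval ![1, 0, 0]) h
    simp [hL] at this
  rw [hpull]
  refine ⟨dvd_mul_right _ _, fun h => ?_⟩
  rw [pow_succ] at h
  obtain ⟨T, hT⟩ := (mul_dvd_mul_iff_left (pow_ne_zero k hL0)).mp h
  rw [hT, map_mul, hφL, zero_mul, Polynomial.coeff_zero] at hφS
  exact mul_ne_zero (mem_support_iff.mp he) (pow_ne_zero _ (by norm_num)) hφS.symm
end

section
/- Let P ∈ ℂ[x,y,z] be a nonzero homogeneous polynomial, and let ν₃(P) be the unique natural number such that P(1+u+u²v, 1, u) = u^{ν₃(P)}·Q(u,v) in ℂ[u,v] with Q not divisible by u. Then z^{ν₃(P)} divides P(x(x−y+z)+(x−y)z, x(x−y+z), z(x−y+z)) in ℂ[x,y,z], and z^{ν₃(P)+1} does not divide it. -/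
open MvPolynomial

namespace LinearizableMap

/-- A homogeneous polynomial of degree `n` scales by `c ^ n`. -/
lemma aeval_const_mul {σ R A : Type*} [CommSemiring R] [CommSemiring A] [Algebra R A]
    {F : MvPolynomial σ R} {n : ℕ} (hF : F.IsHomogeneous n) (c : A) (g : σ → A) :
    aeval (fun i => c * g i) F = c ^ n * aeval g F := by
  simp only [aeval_def, eval₂_eq, Finset.mul_sum]
  refine Finset.sum_congr rfl fun d hd => ?_
  rw [Finset.prod_congr rfl fun i _ => mul_pow c (g i) (d i), Finset.prod_mul_distrib,
    Finset.prod_pow_eq_pow_sum, ← hF.degree_eq_sum_deg_support hd, mul_left_comm]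

/-- The quotient of a homogeneous polynomial by a variable is homogeneous. -/
lemma isHomogeneous_of_X_mul {σ R : Type*} [CommSemiring R] {F : MvPolynomial σ R} {n : ℕ}
    {i : σ} (h : (X i * F).IsHomogeneous n) : F.IsHomogeneous (n - 1) := by
  intro m hm
  have hdeg := h (d := Finsupp.single i 1 + m) (by rwa [coeff_X_mul])
  rw [map_add, Finsupp.weight_single] at hdeg
  simp only [Pi.one_apply, smul_eq_mul, mul_one] at hdeg
  exact Nat.eq_sub_of_add_eq' hdeg

/-- A polynomial in three variables vanishing on `z = 0` is divisible by `z`. -/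
lemma X_two_dvd_of_aeval_eq_zero {R : Type*} [CommRing R] {F : MvPolynomial (Fin 3) R}
    (h : aeval (![X 0, X 1, 0] : Fin 3 → MvPolynomial (Fin 3) R) F = 0) : X 2 ∣ F := by
  have hmk : (Ideal.Quotient.mkₐ R (Ideal.span {(X 2 : MvPolynomial (Fin 3) R)})).comp
      (aeval ![X 0, X 1, 0]) = Ideal.Quotient.mkₐ R (Ideal.span {X 2}) := by
    ext i
    fin_cases i <;> simp
  have hF := DFunLike.congr_fun hmk F
  rw [AlgHom.comp_apply, h, map_zero] at hF
  exact Ideal.mem_span_singleton.mp (Ideal.Quotient.eq_zero_iff_mem.mp hF.symm)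

/-- The affine chart `(u, v) ↦ (-v, -v - uv - 1, -uv)`, in which the linearizable map becomes
`(u, v) ↦ -v • (1 + u + u²v, 1, u)` and the critical line `z = 0` becomes `u = 0`. -/
noncomputable def sourceChart : MvPolynomial (Fin 3) ℂ →ₐ[ℂ] MvPolynomial (Fin 2) ℂ :=
  aeval ![-X 1, -X 1 - X 0 * X 1 - 1, -(X 0 * X 1)]

lemma X_two_dvd_of_X_zero_dvd_sourceChart {F : MvPolynomial (Fin 3) ℂ} {n : ℕ}
    (hF : F.IsHomogeneous n) (h : X 0 ∣ sourceChart F) : X 2 ∣ F := by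
  apply X_two_dvd_of_aeval_eq_zero
  have hne : (X 0 - X 1 : MvPolynomial (Fin 3) ℂ) ≠ 0 :=
    sub_ne_zero.mpr fun h01 => absurd (X_injective h01) (by decide)
  refine (mul_eq_zero.mp (MvPolynomial.funext fun p => ?_)).resolve_left hne
  rw [map_mul, map_zero, mul_eq_zero]
  refine or_iff_not_imp_left.mpr fun hw => ?_
  replace hw : p 0 - p 1 ≠ 0 := by simpa using hw
  have hrestrict : (aeval p).comp (aeval (![X 0, X 1, 0] : Fin 3 → MvPolynomial (Fin 3) ℂ)) =
      aeval fun i => (p 0 - p 1) * (![p 0 / (p 0 - p 1), p 1 / (p 0 - p 1), 0] : Fin 3 → ℂ) i := by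
    ext i
    fin_cases i <;> simp [mul_div_cancel₀, hw]
  have hchart : (aeval (![0, -(p 0 / (p 0 - p 1))] : Fin 2 → ℂ)).comp sourceChart =
      aeval ![p 0 / (p 0 - p 1), p 1 / (p 0 - p 1), 0] := by
    ext i
    fin_cases i
    · simp [sourceChart]
    · simp [sourceChart]
      field_simp
      ring
    · simp [sourceChart]
  rw [← coe_aeval_eq_eval]
  change ((aeval p).comp (aeval ![X 0, X 1, 0])) F = 0
  obtain ⟨G, hG⟩ := h
  rw [hrestrict, aeval_const_mul hF, ← hchart, AlgHom.comp_apply, hG]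
  simp

/-- Division of `F` by powers of `z` can be tested in the chart `sourceChart`. -/
lemma X_two_pow_dvd_of_X_zero_pow_dvd_sourceChart (k : ℕ) {F : MvPolynomial (Fin 3) ℂ} {n : ℕ}
    (hF : F.IsHomogeneous n) (h : X 0 ^ k ∣ sourceChart F) : X 2 ^ k ∣ F := by
  induction k generalizing F n with
  | zero => simp
  | succ k ih =>
    obtain ⟨G, rfl⟩ := X_two_dvd_of_X_zero_dvd_sourceChart hF
      ((dvd_pow_self _ k.succ_ne_zero).trans h)
    rw [pow_succ']
    refine mul_dvd_mul_left _ (ih (isHomogeneous_of_X_mul hF) ?_)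
    have hmul : sourceChart (X 2 * G) = X 0 * (X 1 * -sourceChart G) := by
      simp [sourceChart]
      ring
    rw [hmul, pow_succ', mul_dvd_mul_iff_left (X_ne_zero 0)] at h
    exact dvd_neg.mp ((X_prime (i := (0 : Fin 2))).pow_dvd_of_dvd_mul_left k
      (by simp [X_dvd_X]) h)

/-- The coordinates of the minimal lift of the linearizable map. -/
noncomputable abbrev lift : Fin 3 → MvPolynomial (Fin 3) ℂ :=
  ![X 0 * (X 0 - X 1 + X 2) + (X 0 - X 1) * X 2,
    X 0 * (X 0 - X 1 + X 2), X 2 * (X 0 - X 1 + X 2)]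

lemma isHomogeneous_lift (i : Fin 3) : (lift i).IsHomogeneous 2 := by
  have hX (j : Fin 3) := isHomogeneous_X ℂ j
  have hw : (X 0 - X 1 + X 2 : MvPolynomial (Fin 3) ℂ).IsHomogeneous 1 :=
    ((hX 0).sub (hX 1)).add (hX 2)
  fin_cases i
  · exact ((hX 0).mul hw).add (((hX 0).sub (hX 1)).mul (hX 2))
  · exact (hX 0).mul hw
  · exact (hX 2).mul hw

lemma sourceChart_aeval_lift {P : MvPolynomial (Fin 3) ℂ} {D : ℕ} (hP : P.IsHomogeneous D) :
    sourceChart (aeval lift P) =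
      (-X 1) ^ D * aeval (![1 + X 0 + X 0 ^ 2 * X 1, 1, X 0] :
        Fin 3 → MvPolynomial (Fin 2) ℂ) P := by
  rw [← aeval_const_mul hP, ← AlgHom.comp_apply]
  congr 1
  ext1 i
  fin_cases i <;> simp [sourceChart] <;> ring

end LinearizableMap

open LinearizableMap in
/-- Part 2 of Proposition 12.1 (Example 3, the linearizable map
`f[x:y:z] = [x(x−y+z)+(x−y)z : x(x−y+z) : z(x−y+z)]`): if `ν₃(P)` is the local index of
a nonzero homogeneous polynomial `P` with respect to the blow-up chart
`(u,v) ↦ [1+u+u²v : 1 : u]`, i.e. `P(1+u+u²v,1,u) = u^{ν₃(P)}·Q(u,v)` with `u ∤ Q`,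
then `z^{ν₃(P)}` divides the pull-back `f*P` and `z^{ν₃(P)+1}` does not. -/
theorem stmt4 (P : MvPolynomial (Fin 3) ℂ) (hP : P ≠ 0) (D : ℕ)
    (hPhom : P.IsHomogeneous D)
    (k : ℕ) (Q : MvPolynomial (Fin 2) ℂ)
    (hQ : ¬ (X 0 : MvPolynomial (Fin 2) ℂ) ∣ Q)
    (hfact : aeval (![1 + X 0 + X 0 ^ 2 * X 1, 1, X 0] :
        Fin 3 → MvPolynomial (Fin 2) ℂ) P = X 0 ^ k * Q) :
    ((X 2 : MvPolynomial (Fin 3) ℂ) ^ k ∣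
        aeval (![X 0 * (X 0 - X 1 + X 2) + (X 0 - X 1) * X 2,
          X 0 * (X 0 - X 1 + X 2), X 2 * (X 0 - X 1 + X 2)] :
          Fin 3 → MvPolynomial (Fin 3) ℂ) P) ∧
    ¬ ((X 2 : MvPolynomial (Fin 3) ℂ) ^ (k + 1) ∣
        aeval (![X 0 * (X 0 - X 1 + X 2) + (X 0 - X 1) * X 2,
          X 0 * (X 0 - X 1 + X 2), X 2 * (X 0 - X 1 + X 2)] :
          Fin 3 → MvPolynomial (Fin 3) ℂ) P) := by
  have hchart : sourceChart (aeval lift P) = X 0 ^ k * ((-X 1) ^ D * Q) := by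
    rw [sourceChart_aeval_lift hPhom, hfact, mul_left_comm]
  constructor
  · exact X_two_pow_dvd_of_X_zero_pow_dvd_sourceChart k (hPhom.aeval lift isHomogeneous_lift)
      (hchart ▸ dvd_mul_right _ _)
  · intro hdvd
    have hz : X 0 ∣ sourceChart (X 2) := ⟨-X 1, by simp [sourceChart]⟩
    have hu := (pow_dvd_pow_of_dvd hz (k + 1)).trans (map_pow sourceChart _ _ ▸
      map_dvd sourceChart hdvd)
    rw [hchart, pow_succ, mul_dvd_mul_iff_left (pow_ne_zero k (X_ne_zero 0))] at hu
    have hprime := X_prime (R := ℂ) (i := (0 : Fin 2))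
    refine (hprime.dvd_or_dvd hu).elim (fun hv => ?_) hQ
    have := hprime.dvd_of_dvd_pow hv
    simp [X_dvd_X] at this
end

section
/- Let d, ν₁, ν₂, ν₃, ν₄, ν₅, ν₆, ν₇, ν₈, ν₉ : ℕ → ℤ be sequences satisfying, for all n ≥ 0: d(n+1) = 2d(n) − ν₁(n) − ν₂(n) − ν₃(n); ν₁(n+1) = ν₄(n); ν₂(n+1) = ν₅(n); ν₃(n+1) = ν₆(n); ν₄(n+1) = ν₇(n); ν₅(n+1) = ν₈(n); ν₆(n+1) = ν₉(n); ν₇(n+1) = d(n) − ν₂(n) − ν₃(n); ν₈(n+1) = d(n) − ν₁(n) − ν₃(n); ν₉(n+1) = d(n) − ν₁(n) − ν₂(n). If moreover d(0) = 1 and νᵢ(0) = 0 for i = 1,…,9, then for every n ≥ 0 one has 8·d(n) = 6n² + 9 + (−1)^{n+1}, i.e. d(n) = (3/4)n² + (9+(−1)^{n+1})/8. -/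
/-- Theorem 9.1 (Example 1, the integrable quadratic family): the recurrence system
for degrees `d(n)` and local indices `νᵢ(n)`, with initial data coming from a generic
linear polynomial, yields `deg(f^n) = (3/4)n² + (9+(−1)^{n+1})/8`,
i.e. `8·d(n) = 6n² + 9 + (−1)^{n+1}`. -/
theorem stmt5 (d ν1 ν2 ν3 ν4 ν5 ν6 ν7 ν8 ν9 : ℕ → ℤ)
    (hd : ∀ n, d (n+1) = 2 * d n - ν1 n - ν2 n - ν3 n)
    (h1 : ∀ n, ν1 (n+1) = ν4 n)
    (h2 : ∀ n, ν2 (n+1) = ν5 n)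
    (h3 : ∀ n, ν3 (n+1) = ν6 n)
    (h4 : ∀ n, ν4 (n+1) = ν7 n)
    (h5 : ∀ n, ν5 (n+1) = ν8 n)
    (h6 : ∀ n, ν6 (n+1) = ν9 n)
    (h7 : ∀ n, ν7 (n+1) = d n - ν2 n - ν3 n)
    (h8 : ∀ n, ν8 (n+1) = d n - ν1 n - ν3 n)
    (h9 : ∀ n, ν9 (n+1) = d n - ν1 n - ν2 n)
    (hd0 : d 0 = 1)
    (h10 : ν1 0 = 0) (h20 : ν2 0 = 0) (h30 : ν3 0 = 0)
    (h40 : ν4 0 = 0) (h50 : ν5 0 = 0) (h60 : ν6 0 = 0)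
    (h70 : ν7 0 = 0) (h80 : ν8 0 = 0) (h90 : ν9 0 = 0) :
    ∀ n : ℕ, 8 * d n = 6 * (n : ℤ)^2 + 9 + (-1)^(n+1) := by
  have closed_form : ∀ n : ℕ, 8 * d n = 6 * (n : ℤ)^2 + 9 - (-1)^n ∧
      8 * ν1 n = 2 * (n : ℤ)^2 - 4 * n + 1 - (-1)^n ∧
      8 * ν2 n = 2 * (n : ℤ)^2 - 4 * n + 1 - (-1)^n ∧
      8 * ν3 n = 2 * (n : ℤ)^2 - 4 * n + 1 - (-1)^n ∧
      8 * ν4 n = 2 * (n : ℤ)^2 - 1 + (-1)^n ∧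
      8 * ν5 n = 2 * (n : ℤ)^2 - 1 + (-1)^n ∧
      8 * ν6 n = 2 * (n : ℤ)^2 - 1 + (-1)^n ∧
      8 * ν7 n = 2 * ((n : ℤ) + 1)^2 - 1 - (-1)^n ∧
      8 * ν8 n = 2 * ((n : ℤ) + 1)^2 - 1 - (-1)^n ∧
      8 * ν9 n = 2 * ((n : ℤ) + 1)^2 - 1 - (-1)^n := by
    intro n
    induction n with
    | zero => simp [*]
    | succ n ih =>
      obtain ⟨ihd, i1, i2, i3, i4, i5, i6, i7, i8, i9⟩ := ih
      rw [hd, h1, h2, h3, h4, h5, h6, h7, h8, h9, pow_succ (-1 : ℤ) n]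
      push_cast
      refine ⟨?_, ?_, ?_, ?_, ?_, ?_, ?_, ?_, ?_, ?_⟩ <;> linarith
  intro n
  rw [(closed_form n).1, pow_succ (-1 : ℤ) n]
  ring
end

section
/- Let d, ν₁, ν₂, ν₃, ν₄, ν₅, ν₆, ν₇, ν₈, ν₉ : ℕ → ℤ be sequences satisfying, for all n ≥ 0: d(n+1) = 2d(n) − ν₁(n) − ν₂(n) − ν₃(n); ν₁(n+1) = ν₄(n); ν₂(n+1) = ν₅(n); ν₃(n+1) = ν₆(n); ν₄(n+1) = ν₇(n); ν₅(n+1) = ν₈(n); ν₆(n+1) = ν₉(n); ν₇(n+1) = d(n) − ν₂(n) − ν₃(n); ν₈(n+1) = d(n) − ν₁(n) − ν₃(n); ν₉(n+1) = d(n) − ν₁(n) − ν₂(n). Then for all n ≥ 0 one has d(n+4) − 2d(n+3) + 2d(n+1) − d(n) = 0. -/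
/-- Remark 9.2 (Example 1): eliminating the local indices from the recurrence system of
Theorem 9.1 yields the linear recurrence `d(n+1) − 2d(n) + 2d(n−2) − d(n−3) = 0`
for the degrees. -/
theorem stmt6 (d ν1 ν2 ν3 ν4 ν5 ν6 ν7 ν8 ν9 : ℕ → ℤ)
    (hd : ∀ n, d (n+1) = 2 * d n - ν1 n - ν2 n - ν3 n)
    (h1 : ∀ n, ν1 (n+1) = ν4 n)
    (h2 : ∀ n, ν2 (n+1) = ν5 n)
    (h3 : ∀ n, ν3 (n+1) = ν6 n)
    (h4 : ∀ n, ν4 (n+1) = ν7 n)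
    (h5 : ∀ n, ν5 (n+1) = ν8 n)
    (h6 : ∀ n, ν6 (n+1) = ν9 n)
    (h7 : ∀ n, ν7 (n+1) = d n - ν2 n - ν3 n)
    (h8 : ∀ n, ν8 (n+1) = d n - ν1 n - ν3 n)
    (h9 : ∀ n, ν9 (n+1) = d n - ν1 n - ν2 n) :
    ∀ n : ℕ, d (n+4) - 2 * d (n+3) + 2 * d (n+1) - d n = 0 := by
  intro n
  linarith [hd n, hd (n+3), h1 (n+2), h2 (n+2), h3 (n+2), h4 (n+1), h5 (n+1), h6 (n+1),
    h7 n, h8 n, h9 n]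
end

section
/- Let d, ν₂, ν₃, ν₅, ν₆, ν₈, ν₁₀ : ℕ → ℤ be sequences satisfying, for all n ≥ 0: d(n+1) = 2d(n) − ν₂(n) − ν₃(n); ν₂(n+1) = ν₅(n) − 2ν₃(n); ν₃(n+1) = ν₆(n); ν₅(n+1) = ν₈(n); ν₆(n+1) = d(n) − ν₂(n); ν₈(n+1) = 2d(n) − 2ν₂(n) + ν₁₀(n); ν₁₀(n+1) = 2d(n) − ν₂(n) − 2ν₃(n). If moreover d(0) = 1 and ν₂(0) = ν₃(0) = ν₅(0) = ν₆(0) = ν₈(0) = ν₁₀(0) = 0, then for every n ≥ 0: 3·d(n) = 2n² + 3 if 3 divides n, and 3·d(n) = 2n² + 4 otherwise; equivalently, d(n) = (1/9)(6n² − 2cos(2πn/3) + 11). -/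
/-- Theorem 10.1 together with formula (dP1 2D d expl) (Example 2, the dPI map):
the recurrence system for degrees `d(n)` and local indices, with initial data from a
generic linear polynomial, yields `d(n) = (1/9)(6n² − 2cos(2πn/3) + 11)`, i.e.
`3·d(n) = 2n² + 3` if `3 ∣ n` and `3·d(n) = 2n² + 4` otherwise. -/
theorem stmt7 (d ν2 ν3 ν5 ν6 ν8 ν10 : ℕ → ℤ)
    (hd : ∀ n, d (n+1) = 2 * d n - ν2 n - ν3 n)
    (h2 : ∀ n, ν2 (n+1) = ν5 n - 2 * ν3 n)
    (h3 : ∀ n, ν3 (n+1) = ν6 n)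
    (h5 : ∀ n, ν5 (n+1) = ν8 n)
    (h6 : ∀ n, ν6 (n+1) = d n - ν2 n)
    (h8 : ∀ n, ν8 (n+1) = 2 * d n - 2 * ν2 n + ν10 n)
    (h10 : ∀ n, ν10 (n+1) = 2 * d n - ν2 n - 2 * ν3 n)
    (hd0 : d 0 = 1)
    (h20 : ν2 0 = 0) (h30 : ν3 0 = 0) (h50 : ν5 0 = 0)
    (h60 : ν6 0 = 0) (h80 : ν8 0 = 0) (h100 : ν10 0 = 0) :
    ∀ n : ℕ, 3 * d n = 2 * (n : ℤ)^2 + (if 3 ∣ n then 3 else 4) := by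
  have key : ∀ k : ℕ, d (3 * k) = 6 * (k : ℤ) ^ 2 + 1 ∧ ν2 (3 * k) = 3 * (k : ℤ) ^ 2 - 3 * k ∧
      ν3 (3 * k) = 3 * (k : ℤ) ^ 2 - k ∧ ν5 (3 * k) = 9 * (k : ℤ) ^ 2 - 3 * k ∧
      ν6 (3 * k) = 3 * (k : ℤ) ^ 2 + k ∧ ν8 (3 * k) = 9 * (k : ℤ) ^ 2 + 3 * k ∧
      ν10 (3 * k) = 3 * (k : ℤ) ^ 2 + 3 * k := by
    intro k
    induction k with
    | zero => simp [*]
    | succ k ih =>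
      obtain ⟨e1, e2, e3, e5, e6, e8, e10⟩ := ih
      rw [show 3 * (k + 1) = 3 * k + 1 + 1 + 1 by ring]
      simp only [hd, h2, h3, h5, h6, h8, h10, e1, e2, e3, e5, e6, e8, e10]
      push_cast
      refine ⟨?_, ?_, ?_, ?_, ?_, ?_, ?_⟩ <;> ring
  intro n
  obtain ⟨k, rfl | rfl | rfl⟩ : ∃ k, n = 3 * k ∨ n = 3 * k + 1 ∨ n = 3 * k + 1 + 1 :=
    ⟨n / 3, by omega⟩ <;> obtain ⟨e1, e2, e3, e5, e6, -, -⟩ := key k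
  · rw [if_pos (by omega), e1]
    push_cast
    ring
  · rw [if_neg (by omega), hd, e1, e2, e3]
    push_cast
    ring
  · rw [if_neg (by omega), hd, hd, h2, h3, e1, e2, e3, e5, e6]
    push_cast
    ring
end

section
/- Let d, ν₂, ν₃, ν₅, ν₆, ν₈, ν₁₀ : ℕ → ℤ be sequences satisfying, for all n ≥ 0: d(n+1) = 2d(n) − ν₂(n) − ν₃(n); ν₂(n+1) = ν₅(n) − 2ν₃(n); ν₃(n+1) = ν₆(n); ν₅(n+1) = ν₈(n); ν₆(n+1) = d(n) − ν₂(n); ν₈(n+1) = 2d(n) − 2ν₂(n) + ν₁₀(n); ν₁₀(n+1) = 2d(n) − ν₂(n) − 2ν₃(n). Then for all n ≥ 0 one has d(n+7) − 2d(n+6) + d(n+4) + d(n+3) − 2d(n+1) + d(n) = 0. -/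
/-- Corollary 10.2 (Example 2, the dPI map): the recurrence system of Theorem 10.1
implies the linear recurrence
`d(n+1) − 2d(n) + d(n−2) + d(n−3) − 2d(n−5) + d(n−6) = 0` for the degrees. -/
theorem stmt8 (d ν2 ν3 ν5 ν6 ν8 ν10 : ℕ → ℤ)
    (hd : ∀ n, d (n+1) = 2 * d n - ν2 n - ν3 n)
    (h2 : ∀ n, ν2 (n+1) = ν5 n - 2 * ν3 n)
    (h3 : ∀ n, ν3 (n+1) = ν6 n)
    (h5 : ∀ n, ν5 (n+1) = ν8 n)
    (h6 : ∀ n, ν6 (n+1) = d n - ν2 n)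
    (h8 : ∀ n, ν8 (n+1) = 2 * d n - 2 * ν2 n + ν10 n)
    (h10 : ∀ n, ν10 (n+1) = 2 * d n - ν2 n - 2 * ν3 n) :
    ∀ n : ℕ, d (n+7) - 2 * d (n+6) + d (n+4) + d (n+3) - 2 * d (n+1) + d n = 0 := by
  intro n
  simp only [hd, h2, h3, h5, h6, h8, h10]
  ring
end

section
/- Let d, μ₁, …, μ₁₀ : ℕ → ℤ be sequences satisfying, for all n ≥ 0: d(n+1) = 2d(n) − μ₁(n) − μ₂(n) − μ₃(n); μ₁(n+1) = μ₄(n); μ₂(n+1) = μ₅(n); μ₃(n+1) = μ₆(n); μ₄(n+1) = μ₇(n); μ₅(n+1) = μ₈(n); μ₆(n+1) = d(n) − μ₁(n) − μ₂(n); μ₇(n+1) = μ₉(n); μ₈(n+1) = μ₁₀(n); μ₉(n+1) = d(n) − μ₂(n) − μ₃(n); μ₁₀(n+1) = d(n) − μ₁(n) − μ₃(n). If moreover d(0) = 1 and μᵢ(0) = 0 for i = 1,…,10, then for every n ≥ 0: 3·d(n) = 2n² + 3 if 3 divides n, and 3·d(n) = 2n² + 4 otherwise; equivalently, d(n) = (1/9)(6n²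 − 2cos(2πn/3) + 11). -/
/-- Theorem 10.3 together with formula (dP1 2D d expl) (Example 2, the dPI map, Picard
group method): the recurrence system for degrees `d(n)` and Picard coefficients `μᵢ(n)`,
with initial data from a generic line, yields `d(n) = (1/9)(6n² − 2cos(2πn/3) + 11)`,
i.e. `3·d(n) = 2n² + 3` if `3 ∣ n` and `3·d(n) = 2n² + 4` otherwise. -/
theorem stmt9 (d μ1 μ2 μ3 μ4 μ5 μ6 μ7 μ8 μ9 μ10 : ℕ → ℤ)
    (hd : ∀ n, d (n+1) = 2 * d n - μ1 n - μ2 n - μ3 n)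
    (h1 : ∀ n, μ1 (n+1) = μ4 n)
    (h2 : ∀ n, μ2 (n+1) = μ5 n)
    (h3 : ∀ n, μ3 (n+1) = μ6 n)
    (h4 : ∀ n, μ4 (n+1) = μ7 n)
    (h5 : ∀ n, μ5 (n+1) = μ8 n)
    (h6 : ∀ n, μ6 (n+1) = d n - μ1 n - μ2 n)
    (h7 : ∀ n, μ7 (n+1) = μ9 n)
    (h8 : ∀ n, μ8 (n+1) = μ10 n)
    (h9 : ∀ n, μ9 (n+1) = d n - μ2 n - μ3 n)
    (h10 : ∀ n, μ10 (n+1) = d n - μ1 n - μ3 n)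
    (hd0 : d 0 = 1)
    (h10' : μ1 0 = 0) (h20 : μ2 0 = 0) (h30 : μ3 0 = 0) (h40 : μ4 0 = 0)
    (h50 : μ5 0 = 0) (h60 : μ6 0 = 0) (h70 : μ7 0 = 0) (h80 : μ8 0 = 0)
    (h90 : μ9 0 = 0) (h100 : μ10 0 = 0) :
    ∀ n : ℕ, 3 * d n = 2 * (n : ℤ)^2 + (if 3 ∣ n then 3 else 4) := by
  -- Along `n = 3k` every coefficient is a quadratic polynomial in `k`.
  have key : ∀ k : ℕ, d (3 * k) = 6 * (k : ℤ) ^ 2 + 1 ∧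
      2 * μ1 (3 * k) = 3 * (k : ℤ) ^ 2 - 3 * k ∧ 2 * μ2 (3 * k) = 3 * (k : ℤ) ^ 2 - 3 * k ∧
      μ3 (3 * k) = 3 * (k : ℤ) ^ 2 - k ∧
      2 * μ4 (3 * k) = 3 * (k : ℤ) ^ 2 - k ∧ 2 * μ5 (3 * k) = 3 * (k : ℤ) ^ 2 - k ∧
      μ6 (3 * k) = 3 * (k : ℤ) ^ 2 + k ∧
      2 * μ7 (3 * k) = 3 * (k : ℤ) ^ 2 + k ∧ 2 * μ8 (3 * k) = 3 * (k : ℤ) ^ 2 + k ∧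
      2 * μ9 (3 * k) = 3 * (k : ℤ) ^ 2 + 3 * k ∧
      2 * μ10 (3 * k) = 3 * (k : ℤ) ^ 2 + 3 * k := by
    intro k
    induction k with
    | zero => simp [*]
    | succ k ih =>
      obtain ⟨e0, e1, e2, e3, e4, e5, e6, e7, e8, e9, e10⟩ := ih
      rw [show 3 * (k + 1) = 3 * k + 1 + 1 + 1 by ring]
      simp only [hd, h1, h2, h3, h4, h5, h6, h7, h8, h9, h10]
      push_cast
      refine ⟨?_, ?_, ?_, ?_, ?_, ?_, ?_, ?_, ?_, ?_, ?_⟩ <;> linarith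
  intro n
  obtain ⟨k, rfl | rfl | rfl⟩ : ∃ k, n = 3 * k ∨ n = 3 * k + 1 ∨ n = 3 * k + 1 + 1 :=
    ⟨n / 3, by omega⟩ <;>
  obtain ⟨e0, e1, e2, e3, e4, e5, e6, -⟩ := key k
  · rw [if_pos (by omega), e0]
    push_cast
    ring
  · rw [if_neg (by omega), hd]
    push_cast
    linarith
  · rw [if_neg (by omega)]
    simp only [hd, h1, h2, h3]
    push_cast
    linarith
end

section
/- Let P ∈ ℂ[x,y,z] be a nonzero homogeneous polynomial of degree d, and define (f*P)(x,y,z) := P(x(x−y+z)+(x−y)z, x(x−y+z), z(x−y+z)). Let k be the unique natural number such that P(1+uv, 1, u) = u^k·Q(u,v) in ℂ[u,v] with Q not divisible by u. Then the unique natural number k' such that (f*P)(1+uv, 1, u) = u^{k'}·Q'(u,v) with Q' not divisible by u equals k' = d + k. -/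
open MvPolynomial

theorem MvPolynomial.aeval_mul_left_of_isHomogeneous {σ R A : Type*} [CommSemiring R]
    [CommSemiring A] [Algebra R A] {P : MvPolynomial σ R} {d : ℕ} (hP : P.IsHomogeneous d)
    (c : A) (g : σ → A) :
    aeval (fun i => c * g i) P = c ^ d * aeval g P := by
  simp only [aeval_def, eval₂_eq, Finset.mul_sum]
  refine Finset.sum_congr rfl fun m hm => ?_
  have hdeg : ∑ i ∈ m.support, m i = d := by
    rw [← hP (mem_support_iff.mp hm), Finsupp.weight_apply]
    simp [Finsupp.sum]
  simp only [mul_pow, Finset.prod_mul_distrib, Finset.prod_pow_eq_pow_sum, hdeg]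
  ring

/-- A polynomial in `u, v` that vanishes at `u = 0` and transcendental `v` is divisible by `u`. -/
theorem MvPolynomial.X_zero_dvd_of_aeval_eq_zero {R A : Type*} [CommRing R] [CommRing A]
    [Algebra R A] {w : A} (hw : Transcendental R w) {Q : MvPolynomial (Fin 2) R}
    (hQ : aeval ![0, w] Q = 0) : X 0 ∣ Q := by
  have hq : aeval (![0, Polynomial.X] : Fin 2 → Polynomial R) Q = 0 := by
    refine transcendental_iff.mp hw _ ?_
    rw [← hQ, ← AlgHom.comp_apply]
    congr 1
    ext i
    fin_cases i <;> simp
  have hQ0 : aeval (![0, X 1] : Fin 2 → MvPolynomial (Fin 2) R) Q = 0 := by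
    have h : ((Polynomial.aeval (X 1 : MvPolynomial (Fin 2) R)).comp
        (aeval (![0, Polynomial.X] : Fin 2 → Polynomial R))) = aeval ![0, X 1] := by
      ext i : 1
      fin_cases i <;> simp
    rw [← h, AlgHom.comp_apply, hq, map_zero]
  have h : (Ideal.Quotient.mkₐ R (Ideal.span {(X 0 : MvPolynomial (Fin 2) R)})).comp
      (aeval ![0, X 1]) = Ideal.Quotient.mkₐ R _ := by
    ext i : 1
    fin_cases i
    · simp
    · simp
  rw [← Ideal.mem_span_singleton, ← Ideal.Quotient.eq_zero_iff_mem,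
    ← Ideal.Quotient.mkₐ_eq_mk R, ← h, AlgHom.comp_apply, hQ0, map_zero]

theorem eq_of_pow_mul_eq_pow_mul {M : Type*} [CommMonoidWithZero M] [IsCancelMulZero M]
    {p a b : M} {m n : ℕ} (hp : p ≠ 0) (ha : ¬ p ∣ a) (hb : ¬ p ∣ b)
    (h : p ^ m * a = p ^ n * b) : m = n := by
  wlog hmn : m ≤ n generalizing m n a b
  · exact (this hb ha h.symm (le_of_not_ge hmn)).symm
  obtain ⟨j, rfl⟩ := Nat.exists_eq_add_of_le hmn
  rw [pow_add, mul_assoc] at h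
  have h' := mul_left_cancel₀ (pow_ne_zero m hp) h
  rcases j with _ | j
  · rfl
  · exact absurd ⟨p ^ j * b, by rw [h', pow_succ', mul_assoc]⟩ ha

theorem not_powerSeries_X_dvd_aeval {R K : Type*} [CommRing R] [Field K] [Algebra R K]
    {w : K} (hw : Transcendental R w) {Q : MvPolynomial (Fin 2) R}
    (hQ : ¬ X 0 ∣ Q) {U : PowerSeries K} (hU : PowerSeries.constantCoeff U = 0) :
    ¬ PowerSeries.X ∣ aeval ![U, PowerSeries.C w] Q := by
  rw [PowerSeries.X_dvd_iff]
  intro h0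
  refine hQ (X_zero_dvd_of_aeval_eq_zero hw (Eq.trans ?_ h0))
  rw [aeval_def, aeval_def, hom_eval₂]
  congr 1
  ext i
  fin_cases i <;> simp [hU]

theorem Transcendental.add_one_ne_zero {R A : Type*} [CommRing R] [Nontrivial R] [CommRing A]
    [Algebra R A] {v : A} (hv : Transcendental R v) : v + 1 ≠ 0 := fun h =>
  hv (eq_neg_of_add_eq_zero_left h ▸ isAlgebraic_one.neg)

theorem Transcendental.div_add_one {F K : Type*} [Field F] [Field K] [Algebra F K] {v : K}
    (hv : Transcendental F v) : Transcendental F (v / (v + 1)) := by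
  intro h
  have hv1 : v + 1 ≠ 0 := hv.add_one_ne_zero
  refine hv ?_
  have e : v = (1 - v / (v + 1))⁻¹ - 1 := by
    field_simp
    simp
  rw [e]
  exact ((isAlgebraic_one.sub h).inv).sub isAlgebraic_one

/-- Equation (A pullback nu2) of Lemma 12.2 (Example 3, the linearizable map):
for the local index `ν₂` with respect to the blow-up chart `(u,v) ↦ [1+uv : 1 : u]`,
one has `ν₂(f*P) = deg(P) + ν₂(P)`, where `f*P = P∘f̃` with
`f̃(x,y,z) = (x(x−y+z)+(x−y)z, x(x−y+z), z(x−y+z))`. -/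
theorem stmt13 (P : MvPolynomial (Fin 3) ℂ) (hP : P ≠ 0) (d : ℕ)
    (hPhom : P.IsHomogeneous d)
    (k : ℕ) (Q : MvPolynomial (Fin 2) ℂ)
    (hQ : ¬ (X 0 : MvPolynomial (Fin 2) ℂ) ∣ Q)
    (hfact : aeval (![1 + X 0 * X 1, 1, X 0] : Fin 3 → MvPolynomial (Fin 2) ℂ) P
      = X 0 ^ k * Q)
    (k' : ℕ) (Q' : MvPolynomial (Fin 2) ℂ)
    (hQ' : ¬ (X 0 : MvPolynomial (Fin 2) ℂ) ∣ Q')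
    (hfact' : aeval (![1 + X 0 * X 1, 1, X 0] : Fin 3 → MvPolynomial (Fin 2) ℂ)
        (aeval (![X 0 * (X 0 - X 1 + X 2) + (X 0 - X 1) * X 2,
          X 0 * (X 0 - X 1 + X 2), X 2 * (X 0 - X 1 + X 2)] :
          Fin 3 → MvPolynomial (Fin 3) ℂ) P)
      = X 0 ^ k' * Q') :
    k' = d + k := by
  let v : RatFunc ℂ := RatFunc.X
  have hv : Transcendental ℂ v := RatFunc.transcendental_X
  have hv1 : v + 1 ≠ 0 := hv.add_one_ne_zero
  -- Work in `ℂ(v)⟦u⟧`, where the chart coordinates `(u * t, V)` of the image point make sense.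
  let u : PowerSeries (RatFunc ℂ) := PowerSeries.X
  let vS : PowerSeries (RatFunc ℂ) := PowerSeries.C v
  let t : PowerSeries (RatFunc ℂ) := (1 + u * vS)⁻¹
  have ht : (1 + u * vS) * t = 1 := PowerSeries.mul_inv_cancel _ (by simp [u])
  let V : PowerSeries (RatFunc ℂ) := PowerSeries.C (v / (v + 1))
  have hV : (vS + 1) * V = vS := by
    simp only [vS, V, ← map_one (PowerSeries.C (R := RatFunc ℂ)), ← map_add, ← map_mul]
    congr 1
    field_simp
  let s : PowerSeries (RatFunc ℂ) := (1 + u * vS) * (vS + 1)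
  have hψ := congrArg (aeval ![u, vS]) hfact'
  have hθ := congrArg (aeval ![u * t, V]) hfact
  simp only [← AlgHom.comp_apply, comp_aeval] at hψ hθ
  have hcoord : (fun i => aeval (fun j => aeval ![u, vS] ((![1 + X 0 * X 1, 1, X 0] :
      Fin 3 → MvPolynomial (Fin 2) ℂ) j)) ((![X 0 * (X 0 - X 1 + X 2) + (X 0 - X 1) * X 2,
          X 0 * (X 0 - X 1 + X 2), X 2 * (X 0 - X 1 + X 2)] :
          Fin 3 → MvPolynomial (Fin 3) ℂ) i)) =
      fun i => (u * s) * aeval ![u * t, V] ((![1 + X 0 * X 1, 1, X 0] :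
        Fin 3 → MvPolynomial (Fin 2) ℂ) i) := by
    funext i
    fin_cases i
    · simp [s]
      linear_combination (-u ^ 2 * (vS + 1) * V) * ht - u ^ 2 * hV
    · simp [s]
      ring
    · simp [s]
      linear_combination (-u ^ 2 * (vS + 1)) * ht
  rw [hcoord, aeval_mul_left_of_isHomogeneous hPhom, hθ] at hψ
  have hs : ¬ u ∣ s := by simp [u, s, vS, PowerSeries.X_dvd_iff, hv1]
  have ht' : ¬ u ∣ t := by simp [u, t, PowerSeries.X_dvd_iff]
  have hu : Prime u := PowerSeries.X_prime
  have hθQ : ¬ u ∣ aeval ![u * t, V] Q :=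
    not_powerSeries_X_dvd_aeval hv.div_add_one hQ (by simp [u])
  have hψQ : ¬ u ∣ aeval ![u, vS] Q' := not_powerSeries_X_dvd_aeval hv hQ' (by simp [u])
  have hprod : ¬ u ∣ s ^ d * (t ^ k * aeval ![u * t, V] Q) :=
    hu.not_dvd_mul (mt hu.dvd_of_dvd_pow hs) (hu.not_dvd_mul (mt hu.dvd_of_dvd_pow ht') hθQ)
  refine eq_of_pow_mul_eq_pow_mul hu.ne_zero hψQ hprod ?_
  simp only [map_mul, map_pow, aeval_X, Matrix.cons_val_zero] at hψ
  rw [← hψ]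
  ring_nf
end

section
/- Let P ∈ ℂ[x,y,z] be a nonzero homogeneous polynomial of degree d, and define (f*P)(x,y,z) := P(x(x−y+z)+(x−y)z, x(x−y+z), z(x−y+z)). Write P(1+uv, 1, u) = u^k·R(u,v) in ℂ[u,v] with R not divisible by u, and assume the genericity condition R(0, 1/2) ≠ 0. Then the unique natural number k' such that (f*P)(1+u+u²v, 1, u) = u^{k'}·S(u,v) with S not divisible by u equals k' = d + k. -/
open MvPolynomial

open Filter Topology

theorem MvPolynomial.IsHomogeneous.eval_smul_eq {σ R : Type*} [CommSemiring R]
    {p : MvPolynomial σ R} {d : ℕ} (hp : p.IsHomogeneous d) (c : R) (x : σ → R) :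
    eval (c • x) p = c ^ d * eval x p := by
  rw [eval_eq, eval_eq, Finset.mul_sum]
  refine Finset.sum_congr rfl fun m hm => ?_
  have hdeg : ∑ i ∈ m.support, m i = d := by
    rw [← hp (mem_support_iff.mp hm), Finsupp.weight_apply]
    simp [Finsupp.sum]
  simp only [Pi.smul_apply, smul_eq_mul, mul_pow, Finset.prod_mul_distrib,
    Finset.prod_pow_eq_pow_sum, hdeg]
  ring

/-- A polynomial vanishing on the hyperplane `x i = 0` is divisible by `X i`. -/
theorem MvPolynomial.X_dvd_of_eval_eq_zero {σ R : Type*} [CommRing R] [IsDomain R] [Infinite R]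
    {i : σ} {p : MvPolynomial σ R} (h : ∀ x : σ → R, x i = 0 → eval x p = 0) : X i ∣ p := by
  classical
  let I : Ideal (MvPolynomial σ R) := Ideal.span {X i}
  let φ : MvPolynomial σ R →ₐ[R] MvPolynomial σ R := aeval (Function.update X i 0)
  have hφ : φ p = 0 := by
    refine MvPolynomial.funext fun x => ?_
    have hcomp : eval x (φ p) = eval (Function.update x i 0) p := by
      have : (aeval x).comp φ = aeval (Function.update x i 0) := by
        ext j
        by_cases hj : j = i
        · subst hj; simp [φ]
        · simp [φ, hj]
      simpa [coe_aeval_eq_eval] using DFunLike.congr_fun this p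
    rw [hcomp, h _ (by simp), map_zero]
  have hmk : (Ideal.Quotient.mkₐ R I).comp φ = Ideal.Quotient.mkₐ R I := by
    ext j
    by_cases hj : j = i
    · subst hj
      have : Ideal.Quotient.mk I (X j) = 0 :=
        Ideal.Quotient.eq_zero_iff_mem.mpr (Ideal.mem_span_singleton_self _)
      simp [φ, this]
    · simp [φ, hj]
  have hp := DFunLike.congr_fun hmk p
  rw [AlgHom.comp_apply, hφ, map_zero] at hp
  exact Ideal.mem_span_singleton.mp (Ideal.Quotient.eq_zero_iff_mem.mp hp.symm)

theorem eq_zero_of_pow_mul_eventuallyEq {𝕜 : Type*} [NontriviallyNormedField 𝕜] {f g : 𝕜 → 𝕜}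
    {m n : ℕ} (hf : ContinuousAt f 0) (hg : ContinuousAt g 0) (hmn : m < n)
    (h : ∀ᶠ u in 𝓝[≠] (0 : 𝕜), u ^ m * f u = u ^ n * g u) : f 0 = 0 := by
  have hlim : Tendsto (fun u => u ^ (n - m) * g u) (𝓝[≠] 0) (𝓝 0) := by
    have : ContinuousAt (fun u => u ^ (n - m) * g u) 0 := by fun_prop
    simpa [ContinuousAt, (Nat.sub_pos_of_lt hmn).ne'] using
      this.tendsto.mono_left nhdsWithin_le_nhds
  refine tendsto_nhds_unique (hf.tendsto.mono_left nhdsWithin_le_nhds) (hlim.congr' ?_)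
  filter_upwards [h, self_mem_nhdsWithin] with u hu hu0
  refine mul_left_cancel₀ (pow_ne_zero m hu0) ?_
  rw [hu, ← mul_assoc, ← pow_add, Nat.add_sub_cancel' hmn.le]

/-- In the charts `[1 + u + u²v : 1 : u]` and `[1 + UV : 1 : U]`, the map acts by
`U = u / (1 + u + u²v)`, `V = (1 + uv) / (2 + uv)`. -/
theorem eval_pullback_chart {K : Type*} [Field K] {P : MvPolynomial (Fin 3) K} {d : ℕ}
    (hP : P.IsHomogeneous d) {u v : K} (hA : 1 + u + u ^ 2 * v ≠ 0) (hB : 2 + u * v ≠ 0) :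
    eval ![u, v] (aeval (![1 + X 0 + X 0 ^ 2 * X 1, 1, X 0] : Fin 3 → MvPolynomial (Fin 2) K)
        (aeval (![X 0 * (X 0 - X 1 + X 2) + (X 0 - X 1) * X 2,
          X 0 * (X 0 - X 1 + X 2), X 2 * (X 0 - X 1 + X 2)] :
          Fin 3 → MvPolynomial (Fin 3) K) P))
      = ((1 + u + u ^ 2 * v) * (u * (2 + u * v))) ^ d *
        eval ![u / (1 + u + u ^ 2 * v), (1 + u * v) / (2 + u * v)]
          (aeval (![1 + X 0 * X 1, 1, X 0] : Fin 3 → MvPolynomial (Fin 2) K) P) := by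
  have hcomp (n : ℕ) (x : Fin n → K) (F : Fin 3 → MvPolynomial (Fin n) K)
      (Q : MvPolynomial (Fin 3) K) : eval x (aeval F Q) = eval (fun i => eval x (F i)) Q := by
    have : (aeval x).comp (aeval F) = aeval (fun i => eval x (F i)) := by
      ext j; simp
    simpa [coe_aeval_eq_eval] using DFunLike.congr_fun this Q
  rw [hcomp, hcomp, hcomp, ← hP.eval_smul_eq]
  congr 2
  ext i
  fin_cases i
  · simp
    field_simp
    ring
  · simp
    exact Or.inl (by ring)
  · simp
    field_simp
    ring

/-- Equation (A pullback nu3) of Lemma 12.2 (Example 3, the linearizable map):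
for generic `P` (namely when the factor `R` in `P(1+uv,1,u) = u^{ν₂(P)}·R` satisfies
`R(0,1/2) ≠ 0`), the local index `ν₃` of the pull-back `f*P` with respect to the chart
`(u,v) ↦ [1+u+u²v : 1 : u]` equals `deg(P) + ν₂(P)`. -/
theorem stmt15 (P : MvPolynomial (Fin 3) ℂ) (hP : P ≠ 0) (d : ℕ)
    (hPhom : P.IsHomogeneous d)
    (k : ℕ) (R : MvPolynomial (Fin 2) ℂ)
    (hR : ¬ (X 0 : MvPolynomial (Fin 2) ℂ) ∣ R)
    (hfact : aeval (![1 + X 0 * X 1, 1, X 0] : Fin 3 → MvPolynomial (Fin 2) ℂ) P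
      = X 0 ^ k * R)
    (hgen : eval (![0, 1/2] : Fin 2 → ℂ) R ≠ 0)
    (k' : ℕ) (S : MvPolynomial (Fin 2) ℂ)
    (hS : ¬ (X 0 : MvPolynomial (Fin 2) ℂ) ∣ S)
    (hfact' : aeval (![1 + X 0 + X 0 ^ 2 * X 1, 1, X 0] :
        Fin 3 → MvPolynomial (Fin 2) ℂ)
        (aeval (![X 0 * (X 0 - X 1 + X 2) + (X 0 - X 1) * X 2,
          X 0 * (X 0 - X 1 + X 2), X 2 * (X 0 - X 1 + X 2)] :
          Fin 3 → MvPolynomial (Fin 3) ℂ) P)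
      = X 0 ^ k' * S) :
    k' = d + k := by
  have hA (v : ℂ) : ∀ᶠ u in 𝓝 (0 : ℂ), 1 + u + u ^ 2 * v ≠ 0 :=
    ContinuousAt.eventually_ne (by fun_prop) (by simp)
  have hB (v : ℂ) : ∀ᶠ u in 𝓝 (0 : ℂ), 2 + u * v ≠ 0 :=
    ContinuousAt.eventually_ne (by fun_prop) (by simp)
  let G (v u : ℂ) : ℂ := ((1 + u + u ^ 2 * v) * (2 + u * v)) ^ d / (1 + u + u ^ 2 * v) ^ k *
    eval ![u / (1 + u + u ^ 2 * v), (1 + u * v) / (2 + u * v)] R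
  have hG (v : ℂ) : ContinuousAt (G v) 0 := by
    have hchart : ContinuousAt
        (fun u : ℂ => ![u / (1 + u + u ^ 2 * v), (1 + u * v) / (2 + u * v)]) 0 := by
      refine continuousAt_pi.mpr fun i => ?_
      fin_cases i
      · exact ContinuousAt.div (by fun_prop) (by fun_prop) (by simp)
      · exact ContinuousAt.div (by fun_prop) (by fun_prop) (by simp)
    exact (ContinuousAt.div (by fun_prop) (by fun_prop) (by simp)).mul
      (ContinuousAt.comp (g := fun x => eval x R) (continuous_eval R).continuousAt hchart)
  have hS_cont (v : ℂ) : ContinuousAt (fun u : ℂ => eval ![u, v] S) 0 :=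
    ((continuous_eval S).comp (f := fun u : ℂ => ![u, v]) (by fun_prop)).continuousAt
  have hSG (v : ℂ) : ∀ᶠ u in 𝓝[≠] (0 : ℂ), u ^ k' * eval ![u, v] S = u ^ (d + k) * G v u := by
    filter_upwards [(hA v).filter_mono nhdsWithin_le_nhds,
      (hB v).filter_mono nhdsWithin_le_nhds] with u hu hu'
    have h := eval_pullback_chart hPhom hu hu'
    rw [hfact, hfact'] at h
    simp only [map_mul, map_pow, eval_X, Matrix.cons_val_zero] at h
    rw [h]
    simp only [G, div_pow, mul_pow, pow_add]
    ring
  rcases lt_trichotomy k' (d + k) with hlt | heq | hgt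
  · refine absurd (X_dvd_of_eval_eq_zero fun x hx => ?_) hS
    have hx' : x = ![0, x 1] := by
      ext i; fin_cases i <;> simp [hx]
    rw [hx']
    exact eq_zero_of_pow_mul_eventuallyEq (hS_cont (x 1)) (hG (x 1)) hlt (hSG (x 1))
  · exact heq
  · have h0 := eq_zero_of_pow_mul_eventuallyEq (hG 0) (hS_cont 0) hgt
      ((hSG 0).mono fun _ h => h.symm)
    simp only [G] at h0
    refine absurd ?_ hgen
    simpa using h0
end

section
/- Let P ∈ ℂ[x,y,z] be a nonzero homogeneous polynomial of degree d, and let k be the unique natural number such that P(1, u, u²v) = u^k·R(u,v) in ℂ[u,v] with R not divisible by u. Then P(u²v(1+u²v), u³v, u⁴v²) = u^{2d+k}·Q(u,v) in ℂ[u,v] for a polynomial Q with Q not divisible by u. -/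
open MvPolynomial

namespace MvPolynomial

variable {σ K S : Type*}

/-- Scaling of the arguments of a homogeneous polynomial. -/
theorem IsHomogeneous.aeval_mul_left [CommSemiring K] [CommSemiring S] [Algebra K S]
    {P : MvPolynomial σ K} {d : ℕ} (hP : P.IsHomogeneous d) (c : S) (g : σ → S) :
    MvPolynomial.aeval (fun i => c * g i) P = c ^ d * MvPolynomial.aeval g P := by
  simp only [aeval_def, eval₂_eq, Finset.mul_sum]
  refine Finset.sum_congr rfl fun m hm => ?_
  have hdeg : ∑ i ∈ m.support, m i = d := by
    rw [← hP (mem_support_iff.mp hm), Finsupp.weight_apply, Finsupp.sum]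
    simp
  rw [← hdeg, ← Finset.prod_pow_eq_pow_sum, mul_left_comm, ← Finset.prod_mul_distrib]
  simp only [mul_pow]

/-- Divisibility by a power of a variable can be tested on power series. -/
theorem X_pow_dvd_iff_coe [CommRing K] {s : σ} {n : ℕ} {p : MvPolynomial σ K} :
    X s ^ n ∣ p ↔ (MvPowerSeries.X s : MvPowerSeries σ K) ^ n ∣ (p : MvPowerSeries σ K) := by
  rw [X_pow_eq_monomial, monomial_one_dvd_iff_modMonomial_eq_zero, MvPowerSeries.X_pow_dvd_iff]
  constructor
  · intro h m hm
    rw [coeff_coe, ← coeff_modMonomial_of_not_le p (s := Finsupp.single s n), h, coeff_zero]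
    simpa using hm
  · intro h
    ext m
    by_cases hm : Finsupp.single s n ≤ m
    · rw [coeff_modMonomial_of_le _ hm, coeff_zero]
    · rw [coeff_modMonomial_of_not_le _ hm, coeff_zero, ← coeff_coe]
      exact h m (by simpa using hm)

/-- Evaluations at congruent points are congruent. -/
theorem dvd_aeval_sub_aeval [CommRing K] [CommRing S] [Algebra K S] {c : S} {f g : σ → S}
    (h : ∀ i, c ∣ f i - g i) (p : MvPolynomial σ K) : c ∣ aeval f p - aeval g p := by
  have hext : (Ideal.Quotient.mkₐ K (Ideal.span {c})).comp (aeval f) =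
      (Ideal.Quotient.mkₐ K (Ideal.span {c})).comp (aeval g) := by
    ext i
    simpa [Ideal.Quotient.eq, Ideal.mem_span_singleton] using h i
  rw [← Ideal.mem_span_singleton, ← Ideal.Quotient.eq]
  exact DFunLike.congr_fun hext p

/-- The inclusion into power series commutes with evaluation. -/
theorem coe_aeval {τ : Type*} [CommRing K] (f : σ → MvPolynomial τ K) (p : MvPolynomial σ K) :
    ((aeval f p : MvPolynomial τ K) : MvPowerSeries τ K) =
      aeval (fun i => (f i : MvPowerSeries τ K)) p := by
  have hext : (coeToMvPowerSeries.algHom K).comp (aeval f) =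
      aeval (fun i => (f i : MvPowerSeries τ K)) := by
    ext i : 1
    simp
  simpa using DFunLike.congr_fun hext p

/-- Replacing the first coordinate `1` by `1 + u²v` in the chart `[1 : u : u²v]` does not change
the `u`-multiplicity of a homogeneous polynomial. -/
theorem IsHomogeneous.exists_aeval_one_add_eq [Field K] {P : MvPolynomial (Fin 3) K} {d : ℕ}
    (hP : P.IsHomogeneous d) {k : ℕ} {R : MvPolynomial (Fin 2) K}
    (hR : ¬ (X 0 : MvPolynomial (Fin 2) K) ∣ R)
    (hfact : MvPolynomial.aeval
      (![1, X 0, X 0 ^ 2 * X 1] : Fin 3 → MvPolynomial (Fin 2) K) P = X 0 ^ k * R) :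
    ∃ Q : MvPolynomial (Fin 2) K,
      MvPolynomial.aeval (![1 + X 0 ^ 2 * X 1, X 0, X 0 ^ 2 * X 1] :
        Fin 3 → MvPolynomial (Fin 2) K) P = X 0 ^ k * Q ∧
      ¬ (X 0 : MvPolynomial (Fin 2) K) ∣ Q := by
  set G := MvPolynomial.aeval (![1 + X 0 ^ 2 * X 1, X 0, X 0 ^ 2 * X 1] :
    Fin 3 → MvPolynomial (Fin 2) K) P with hG
  let u : MvPowerSeries (Fin 2) K := MvPowerSeries.X 0
  let v : MvPowerSeries (Fin 2) K := MvPowerSeries.X 1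
  have hu : u ≠ 0 := fun h =>
    X_ne_zero (R := K) (0 : Fin 2) (coe_injective _ _ (by simpa [u] using h))
  obtain ⟨e, he⟩ : ∃ e, (1 + u ^ 2 * v) * e = 1 := by
    refine IsUnit.exists_right_inv (MvPowerSeries.isUnit_iff_constantCoeff.mpr ?_)
    simp [u, v]
  let w : Fin 2 → MvPowerSeries (Fin 2) K := ![e * u, (1 + u ^ 2 * v) * v]
  have hsubst : MvPolynomial.aeval ![1, e * u, e * (u ^ 2 * v)] P =
      (e * u) ^ k * MvPolynomial.aeval w R := by
    have h := congrArg (MvPolynomial.aeval w) hfact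
    rw [← AlgHom.comp_apply, comp_aeval, map_mul, map_pow, aeval_X] at h
    change _ = (e * u) ^ k * _ at h
    rw [← h]
    congr 2
    funext i
    fin_cases i
    · simp
    · simp [w]
    · simp only [Fin.reduceFinMk, Matrix.cons_val, map_mul, map_pow, aeval_X, w]
      linear_combination (-(e * u ^ 2 * v)) * he
  have hcoe : (G : MvPowerSeries (Fin 2) K) =
      u ^ k * ((1 + u ^ 2 * v) ^ d * e ^ k * MvPolynomial.aeval w R) := by
    have hscale := hP.aeval_mul_left (1 + u ^ 2 * v) ![1, e * u, e * (u ^ 2 * v)]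
    rw [hsubst] at hscale
    rw [hG, coe_aeval]
    calc _ = MvPolynomial.aeval
            (fun i => (1 + u ^ 2 * v) * (![1, e * u, e * (u ^ 2 * v)] : Fin 3 → _) i) P := by
          congr 2
          funext i
          fin_cases i
          · simp [u, v]
          · simp only [Fin.mk_one, Matrix.cons_val_one, Matrix.cons_val_zero, coe_X]
            linear_combination (-u) * he
          · simp only [Fin.reduceFinMk, Matrix.cons_val, coe_mul, coe_pow, coe_X]
            linear_combination (-(u ^ 2 * v)) * he
      _ = _ := by rw [hscale]; ring
  obtain ⟨Q, hQ⟩ : X 0 ^ k ∣ G := X_pow_dvd_iff_coe.mpr ⟨_, hcoe⟩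
  refine ⟨Q, hQ, fun hdvd => hR ?_⟩
  have hQcoe : (Q : MvPowerSeries (Fin 2) K) =
      (1 + u ^ 2 * v) ^ d * e ^ k * MvPolynomial.aeval w R := by
    rw [hQ, coe_mul, coe_pow, coe_X] at hcoe
    exact mul_left_cancel₀ (pow_ne_zero k hu) hcoe
  have hunit : IsUnit ((1 + u ^ 2 * v) ^ d * e ^ k) :=
    ((IsUnit.of_mul_eq_one _ he).pow d).mul
      ((IsUnit.of_mul_eq_one _ ((mul_comm _ _).trans he)).pow k)
  have hQdvd : u ∣ (Q : MvPowerSeries (Fin 2) K) := by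
    simpa [u] using X_pow_dvd_iff_coe (n := 1).mp (by simpa using hdvd)
  rw [hQcoe, hunit.dvd_mul_left] at hQdvd
  have hcongr : u ∣ MvPolynomial.aeval w R - MvPolynomial.aeval ![u, v] R := by
    refine dvd_aeval_sub_aeval (fun i => ?_) R
    fin_cases i
    · exact ⟨e - 1, by simp [w]; ring⟩
    · exact ⟨u * v ^ 2, by simp [w]; ring⟩
  have hcoeR : MvPolynomial.aeval ![u, v] R = (R : MvPowerSeries (Fin 2) K) := by
    conv_rhs => rw [← aeval_X_left_apply R, coe_aeval]
    congr 2
    funext i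
    fin_cases i <;> simp [u, v]
  rw [dvd_sub_right hQdvd, hcoeR] at hcongr
  simpa using X_pow_dvd_iff_coe (n := 1).mpr (by simpa [u] using hcongr)

end MvPolynomial

/-- Key computation in the proof of relation (dP1 2D nu8) of Theorem 10.1 (Example 2,
the dPI map): if `P` is a nonzero homogeneous polynomial of degree `d` with local index
`k = ν₁₀(P)` defined by `P(1, u, u²v) = u^k·R(u,v)`, `u ∤ R`, then
`P(u²v(1+u²v), u³v, u⁴v²) = u^{2d+k}·Q(u,v)` with `Q` not divisible by `u`. -/
theorem stmt19 (P : MvPolynomial (Fin 3) ℂ) (hP : P ≠ 0) (d : ℕ)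
    (hPhom : P.IsHomogeneous d)
    (k : ℕ) (R : MvPolynomial (Fin 2) ℂ)
    (hR : ¬ (X 0 : MvPolynomial (Fin 2) ℂ) ∣ R)
    (hfact : aeval (![1, X 0, X 0 ^ 2 * X 1] : Fin 3 → MvPolynomial (Fin 2) ℂ) P
      = X 0 ^ k * R) :
    ∃ Q : MvPolynomial (Fin 2) ℂ,
      aeval (![X 0 ^ 2 * X 1 * (1 + X 0 ^ 2 * X 1), X 0 ^ 3 * X 1,
          X 0 ^ 4 * X 1 ^ 2] : Fin 3 → MvPolynomial (Fin 2) ℂ) P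
        = X 0 ^ (2 * d + k) * Q ∧
      ¬ (X 0 : MvPolynomial (Fin 2) ℂ) ∣ Q := by
  obtain ⟨Q, hQ, hQdvd⟩ := hPhom.exists_aeval_one_add_eq hR hfact
  refine ⟨X 1 ^ d * Q, ?_, fun h => ?_⟩
  · have hscale := hPhom.aeval_mul_left (X 0 ^ 2 * X 1 : MvPolynomial (Fin 2) ℂ)
      ![1 + X 0 ^ 2 * X 1, X 0, X 0 ^ 2 * X 1]
    rw [hQ] at hscale
    calc _ = _ := by
          congr 2
          funext i
          fin_cases i <;> simp <;> ring
      _ = _ := hscale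
      _ = _ := by ring
  · rcases X_prime.dvd_or_dvd h with h | h
    · simpa using X_dvd_X.mp (X_prime.dvd_of_dvd_pow h)
    · exact hQdvd h
end
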